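/- Let I be a monomial ideal in P = k[x_1,…,x_n] with dim(P/I) = D which is D-stable. Then for every 0 ≤ i < D, the variable x_{n−i} is not a zero divisor in the quotient ring P / (⟨I, x_n, …, x_{n−i+1}⟩ : m^∞), where m = ⟨x_1,…,x_n⟩ is the homogeneous maximal ideal. -/

import Mathlib

open MvPolynomial

/-- `I` is a monomial ideal: it is generated by a set of terms. -/
def IsMonomialIdeal {k : Type*} [Field k] {n : ℕ}
    (I : Ideal (MvPolynomial (Fin n) k)) : Prop :=
  ∃ S : Set (Fin n →₀ ℕ), I = Ideal.span ((fun a => monomial a (1 : k)) '' S)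

/-- A monomial ideal `I` is `ℓ`-stable: for every term `t ∈ I` (with exponent vector `a`
and maximal variable index `w = w(t)`) with `w(t) ≥ n - ℓ` (1-based indexing) and every
`i < w(t)`, the term `x_i · t / x_{w(t)}` also lies in `I`. -/
def LStable {k : Type*} [Field k] {n : ℕ} (ℓ : ℕ)
    (I : Ideal (MvPolynomial (Fin n) k)) : Prop :=
  ∀ a : Fin n →₀ ℕ, monomial a (1 : k) ∈ I →
    ∀ w : Fin n, a w ≠ 0 → (∀ j, a j ≠ 0 → j ≤ w) →
      n - ℓ ≤ (w : ℕ) + 1 →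
      ∀ i : Fin n, i < w →
        monomial (a + Finsupp.single i 1 - Finsupp.single w 1) (1 : k) ∈ I

theorem LStable.monomial_add_mem {k : Type*} [Field k] {n ℓ : ℕ}
    {I : Ideal (MvPolynomial (Fin n) k)} (hI : LStable ℓ I) {w : Fin n}
    (hw : n - ℓ ≤ (w : ℕ) + 1) (p : ℕ) (c b : Fin n →₀ ℕ)
    (hc : ∀ j, c j ≠ 0 → j ≤ w) (hb : ∀ j, b j ≠ 0 → j ≤ w) (hp : p ≤ b.degree)
    (hmem : monomial (c + Finsupp.single w p) (1 : k) ∈ I) :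
    monomial (c + b) (1 : k) ∈ I := by
  induction p generalizing c b with
  | zero =>
    have h : monomial (c + b) (1 : k) = monomial c 1 * monomial b 1 := by
      simp [monomial_mul]
    rw [h]
    exact I.mul_mem_right _ (by simpa using hmem)
  | succ p ih =>
    obtain ⟨i, hi⟩ : ∃ i, b i ≠ 0 := by
      by_contra! h
      obtain rfl : b = 0 := Finsupp.ext h
      simp at hp
    have hle : Finsupp.single i 1 ≤ b := by
      simpa [Finsupp.single_le_iff, Nat.one_le_iff_ne_zero] using hi
    obtain ⟨d, rfl⟩ := exists_add_of_le hle
    rw [← add_assoc]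
    refine ih _ _ (fun j hj => ?_) (fun j hj => hb j ?_) ?_ ?_
    · by_cases hcj : c j = 0
      · refine hb j ?_
        simp only [Finsupp.add_apply, hcj, zero_add] at hj
        simp only [Finsupp.add_apply]
        omega
      · exact hc j hcj
    · simp only [Finsupp.add_apply]
      omega
    · simp only [map_add, Finsupp.degree_single] at hp
      omega
    · rcases (hb i hi).eq_or_lt with rfl | hlt
      · rwa [add_assoc, ← Finsupp.single_add, add_comm 1 p]
      · convert hI _ hmem w (by simp) (fun j hj => ?_) hw i hlt using 2
        · rw [Finsupp.single_add, ← add_assoc, add_right_comm _ (Finsupp.single w 1),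
            add_tsub_cancel_right, add_right_comm]
        · by_contra hjw
          have hcj : c j = 0 := by
            by_contra h
            exact hjw (hc j h)
          have hne : w ≠ j := fun h => hjw h.ge
          simp [hcj, hne] at hj

theorem IsMonomialIdeal.mem_sup_span_X_iff {k : Type*} [Field k] {n : ℕ}
    {I : Ideal (MvPolynomial (Fin n) k)} (hI : IsMonomialIdeal I) (p : Fin n → Prop)
    (f : MvPolynomial (Fin n) k) :
    f ∈ I ⊔ Ideal.span {g | ∃ j : Fin n, p j ∧ g = X j} ↔
      ∀ c ∈ f.support, monomial c (1 : k) ∈ I ∨ ∃ j, p j ∧ c j ≠ 0 := by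
  obtain ⟨S, rfl⟩ := hI
  have hX : {g : MvPolynomial (Fin n) k | ∃ j : Fin n, p j ∧ g = X j} =
      (fun a => monomial a (1 : k)) '' {a | ∃ j, p j ∧ a = Finsupp.single j 1} := by
    ext g
    simp only [Set.mem_ofPred_eq, Set.mem_image]
    constructor
    · rintro ⟨j, hj, rfl⟩
      exact ⟨_, ⟨j, hj, rfl⟩, rfl⟩
    · rintro ⟨_, ⟨j, hj, rfl⟩, rfl⟩
      exact ⟨j, hj, rfl⟩
  rw [hX, ← Ideal.span_union, ← Set.image_union, mem_ideal_span_monomial_image]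
  refine forall₂_congr fun c _ => ?_
  classical
  rw [mem_ideal_span_monomial_image, support_monomial, if_neg one_ne_zero]
  simp only [Finset.mem_singleton, forall_eq]
  constructor
  · rintro ⟨a, ha | ⟨j, hj, rfl⟩, hac⟩
    · exact Or.inl ⟨a, ha, hac⟩
    · exact Or.inr ⟨j, hj, Nat.one_le_iff_ne_zero.1 (by simpa using hac)⟩
  · rintro (⟨a, ha, hac⟩ | ⟨j, hj, hcj⟩)
    · exact ⟨a, Or.inl ha, hac⟩
    · exact ⟨_, Or.inr ⟨j, hj, rfl⟩, by simpa using Nat.one_le_iff_ne_zero.2 hcj⟩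

/-- Let `I` be a `D`-stable monomial ideal with `dim (P/I) = D`.  Then for every
`0 ≤ i < D` the variable `x_{n-i}` is a non zero divisor in the quotient ring
`P / (⟨I, x_n, …, x_{n-i+1}⟩ : m^∞)`: spelled out elementwise, whenever the product
`f · x_{n-i}` lies in the saturation `J_i : m^∞` (i.e. `(f · x_{n-i}) · h ∈ J_i` for all
`h ∈ m^s`, for some `s`, with `J_i := ⟨I, x_n, …, x_{n-i+1}⟩`), already `f` itself lies
in that saturation. -/
theorem not_zeroDivisor_of_dStable
    {k : Type*} [Field k] {n D : ℕ} (hD : D < n)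
    (I : Ideal (MvPolynomial (Fin n) k)) (hmon : IsMonomialIdeal I)
    (hdim : ringKrullDim (MvPolynomial (Fin n) k ⧸ I) = (D : WithBot (WithTop ℕ)))
    (hstab : LStable D I) :
    ∀ i : ℕ, ∀ hi : i < D, ∀ f : MvPolynomial (Fin n) k,
      (∃ s : ℕ, ∀ h ∈ (Ideal.span (Set.range (X : Fin n → MvPolynomial (Fin n) k))) ^ s,
          (f * X (⟨n - 1 - i, by omega⟩ : Fin n)) * h ∈
            I ⊔ Ideal.span {g | ∃ j : Fin n, n - i ≤ (j : ℕ) ∧ g = X j}) →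
      (∃ s : ℕ, ∀ h ∈ (Ideal.span (Set.range (X : Fin n → MvPolynomial (Fin n) k))) ^ s,
          f * h ∈ I ⊔ Ideal.span {g | ∃ j : Fin n, n - i ≤ (j : ℕ) ∧ g = X j}) := by
  rintro i hi f ⟨s, hs⟩
  set w : Fin n := ⟨n - 1 - i, by omega⟩ with hw
  refine ⟨s + 1, fun h hh => ?_⟩
  have hwmem : (X w : MvPolynomial (Fin n) k) ^ s ∈
      (Ideal.span (Set.range (X : Fin n → MvPolynomial (Fin n) k))) ^ s :=
    Ideal.pow_mem_pow (Ideal.subset_span (Set.mem_range_self w)) s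
  have hfw := hs _ hwmem
  rw [mul_assoc, ← pow_succ', hmon.mem_sup_span_X_iff (fun j => n - i ≤ (j : ℕ))] at hfw
  rw [hmon.mem_sup_span_X_iff (fun j => n - i ≤ (j : ℕ))]
  intro c hc
  obtain ⟨a, ha, b, hb, rfl⟩ := Finset.mem_add.1 (support_mul f h hc)
  rw [or_iff_not_imp_right]
  intro hle
  push Not at hle
  have hdeg : s + 1 ≤ b.degree := (mem_pow_idealOfVars_iff (s + 1) h).1 hh b hb
  have hle_w : ∀ j, (a + b) j ≠ 0 → j ≤ w := by
    intro j hj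
    by_contra hjw
    refine hj (hle j ?_)
    rw [not_le, Fin.lt_def] at hjw
    simp only [hw] at hjw
    omega
  have ha_w : ∀ j, a j ≠ 0 → j ≤ w := fun j hj => hle_w j (by simp [hj])
  have hb_w : ∀ j, b j ≠ 0 → j ≤ w := fun j hj => hle_w j (by simp [hj])
  refine hstab.monomial_add_mem (by simp only [hw]; omega) (s + 1) a b ha_w hb_w hdeg ?_
  have hsupp : a + Finsupp.single w (s + 1) ∈ (f * X w ^ (s + 1)).support := by
    rw [mem_support_iff, X_pow_eq_monomial, coeff_mul_monomial, mul_one]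
    exact mem_support_iff.1 ha
  refine (hfw _ hsupp).resolve_right ?_
  rintro ⟨j, hj, hne⟩
  have hwj : w < j := by
    rw [Fin.lt_def]
    simp only [hw]
    omega
  refine hne ?_
  have haj : a j = 0 := by
    by_contra h0
    exact (ha_w j h0).not_gt hwj
  simp [haj, hwj.ne]
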